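/- arXiv:1809.11102 — 4 statements merged into one kernel-verified Lean document; each statement's English description precedes it below -/
import Mathlib

section
/- Let A > 1, a = (A + 1/A)/2, and f_A(z) = (A − 1/φ(z))^{−1/2} for z ∈ ℂ∖[−1,1] (principal square root). For x ∈ (−1,1), write f_A⁺(x) = lim_{ε→0⁺} f_A(x+iε) and f_A⁻(x) = lim_{ε→0⁺} f_A(x−iε). Then for every x ∈ (−1,1): f_A⁺(x) − f_A⁻(x) = −2i√(1−x²) / (√(2A(a−x)) · h_A(x)). -/
open Complex Filter Topology

/-- The inverse Zhukovskii function `φ(z) = z + (z²−1)^{1/2}`, the branch of the square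
root fixed by `(z²−1)^{1/2} := z·(1 − z⁻²)^{1/2}` with the principal square root. -/
noncomputable def phi (z : ℂ) : ℂ := z + z * (1 - 1 / z ^ 2) ^ ((1 : ℂ) / 2)

/-- `f_A(z) = (A − 1/φ(z))^{−1/2}`, principal square root. -/
noncomputable def fA (A : ℝ) (z : ℂ) : ℂ := ((A : ℂ) - 1 / phi z) ^ (-(1 / 2) : ℂ)

/-- `h_A(x) = (A − x − i√(1−x²))^{1/2} + (A − x + i√(1−x²))^{1/2}`,
using principal square roots. -/
noncomputable def hfun (A x : ℝ) : ℂ :=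
  ((A : ℂ) - x - Complex.I * Real.sqrt (1 - x ^ 2)) ^ ((1 : ℂ) / 2) +
  ((A : ℂ) - x + Complex.I * Real.sqrt (1 - x ^ 2)) ^ ((1 : ℂ) / 2)

theorem cpow_half_sq (z : ℂ) : (z ^ ((1 : ℂ) / 2)) ^ 2 = z := by
  rw [one_div]
  exact Complex.cpow_ofNat_inv_pow z 2

theorem cpow_half_re_nonneg (z : ℂ) : 0 ≤ (z ^ ((1 : ℂ) / 2)).re := by
  rw [one_div, Complex.cpow_inv_two_re]
  exact Real.sqrt_nonneg _

/-- Above the real axis (`σ = 1`) or below it (`σ = -1`), the branch of `(z²−1)^{1/2}` used in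
`phi` lies in the same closed half-plane as `z`. -/
theorem sqrt_branch_im_nonneg {σ x ε : ℝ} (hσ : σ ^ 2 = 1) (hε : 0 < ε) {z : ℂ}
    (hre : z.re = x) (him : z.im = σ * ε) :
    0 ≤ σ * (z * (1 - 1 / z ^ 2) ^ ((1 : ℂ) / 2)).im := by
  have hr := cpow_half_re_nonneg (1 - 1 / z ^ 2)
  have hsq := cpow_half_sq (1 - 1 / z ^ 2)
  set r := (1 - 1 / z ^ 2) ^ ((1 : ℂ) / 2)
  have hz : z ≠ 0 := by
    rintro rfl
    simp only [zero_im] at him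
    nlinarith [congrArg (σ * ·) him]
  have hN : 0 < normSq (z ^ 2) := normSq_pos.2 (pow_ne_zero 2 hz)
  have h := congrArg Complex.im hsq
  simp only [pow_two r, mul_im, sub_im, one_im, one_div, inv_im] at h
  have h2 : (z ^ 2).im = 2 * x * (σ * ε) := by
    rw [pow_two, mul_im, hre, him]; ring
  rw [h2] at h
  have h3 : r.re * r.im = x * σ * ε / normSq (z ^ 2) := by
    rw [neg_div] at h
    field_simp at h ⊢
    linarith
  rw [mul_im, hre, him]
  have h4 : σ * (x * r.im + σ * ε * r.re) = σ * x * r.im + ε * r.re := by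
    linear_combination ε * r.re * hσ
  rw [h4]
  have h5 : r.re * (σ * x * r.im) = x ^ 2 * ε / normSq (z ^ 2) := by
    linear_combination σ * x * h3 + x ^ 2 * ε / normSq (z ^ 2) * hσ
  have h6 : 0 ≤ x ^ 2 * ε / normSq (z ^ 2) := by positivity
  rcases hr.eq_or_lt with h0 | hpos
  · rw [← h0, zero_mul, eq_comm, div_eq_zero_iff] at h3
    have hσ0 : σ ≠ 0 := by rintro rfl; norm_num at hσ
    have hx0 : x = 0 := by
      simpa [hσ0, hε.ne', hz] using h3
    simp [hx0, ← h0]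
  · have : 0 ≤ σ * x * r.im := nonneg_of_mul_nonneg_right (h5 ▸ h6) hpos
    positivity

/-- One-sided boundary values of `phi` on the cut `(-1, 1)`. -/
theorem tendsto_phi_cut {σ x : ℝ} (hσ : σ ^ 2 = 1) (hx : x ∈ Set.Ioo (-1 : ℝ) 1) :
    Tendsto (fun ε : ℝ => phi ((x : ℂ) + σ * (ε * I))) (𝓝[>] 0)
      (𝓝 ((x : ℂ) + σ * (I * √(1 - x ^ 2)))) := by
  have hs : 0 < √(1 - x ^ 2) := Real.sqrt_pos.2 (by nlinarith [hx.1, hx.2])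
  have hs2 : √(1 - x ^ 2) ^ 2 = 1 - x ^ 2 := Real.sq_sqrt (by nlinarith [hx.1, hx.2])
  set s := √(1 - x ^ 2)
  have hz : Tendsto (fun ε : ℝ => (x : ℂ) + σ * (ε * I)) (𝓝[>] 0) (𝓝 x) := by
    have : Continuous fun ε : ℝ => (x : ℂ) + σ * (ε * I) := by fun_prop
    simpa using (this.tendsto 0).mono_left nhdsWithin_le_nhds
  refine hz.add ?_
  rw [tendsto_iff_norm_sub_tendsto_zero]
  have hbound : Tendsto (fun ε : ℝ => ‖((x : ℂ) + σ * (ε * I)) ^ 2 - (x : ℂ) ^ 2‖ / s)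
      (𝓝[>] 0) (𝓝 0) := by
    have h := (((hz.pow 2).sub_const ((x : ℂ) ^ 2)).norm).div_const s
    rwa [sub_self, norm_zero, zero_div] at h
  refine squeeze_zero' (Eventually.of_forall fun _ => norm_nonneg _) ?_ hbound
  filter_upwards [self_mem_nhdsWithin] with ε hε
  have hε : 0 < ε := hε
  have hσ0 : σ ≠ 0 := by rintro rfl; norm_num at hσ
  have hσa : |σ| = 1 := (sq_eq_sq₀ (abs_nonneg σ) zero_le_one).1 (by rw [sq_abs, hσ, one_pow])
  set z : ℂ := (x : ℂ) + σ * (ε * I) with hzdef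
  have him : z.im = σ * ε := by simp [hzdef]
  have hz0 : z ≠ 0 := by
    intro h
    rw [h, zero_im, eq_comm] at him
    simp [hσ0, hε.ne'] at him
  have hw := sqrt_branch_im_nonneg (x := x) hσ hε (by simp [hzdef]) him
  have hw2 : (z * (1 - 1 / z ^ 2) ^ ((1 : ℂ) / 2)) ^ 2 = z ^ 2 - 1 := by
    rw [mul_pow, cpow_half_sq]
    field_simp
  set w := z * (1 - 1 / z ^ 2) ^ ((1 : ℂ) / 2)
  have hlow : s ≤ ‖w + σ * (I * s)‖ := by
    calc s ≤ σ * (w + σ * (I * s)).im := by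
          simp only [add_im, mul_im, ofReal_re, ofReal_im, I_re, I_im]
          ring_nf
          rw [hσ]
          linarith
      _ ≤ |σ * (w + σ * (I * s)).im| := le_abs_self _
      _ = |(w + σ * (I * s)).im| := by rw [abs_mul, hσa, one_mul]
      _ ≤ _ := abs_im_le_norm _
  have hσc : (σ : ℂ) ^ 2 = 1 := by exact_mod_cast hσ
  have hsc : (s : ℂ) ^ 2 = 1 - (x : ℂ) ^ 2 := by exact_mod_cast hs2
  rw [le_div_iff₀ hs]
  calc ‖w - σ * (I * s)‖ * s ≤ ‖w - σ * (I * s)‖ * ‖w + σ * (I * s)‖ := by gcongr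
    _ = ‖z ^ 2 - (x : ℂ) ^ 2‖ := by
      rw [← norm_mul]
      congr 1
      linear_combination hw2 - σ ^ 2 * s ^ 2 * I_sq + s ^ 2 * hσc + hsc

/-- One-sided boundary values of `fA` on the cut `(-1, 1)`. -/
theorem tendsto_fA_cut {A σ x : ℝ} (hA : 1 < A) (hσ : σ ^ 2 = 1)
    (hx : x ∈ Set.Ioo (-1 : ℝ) 1) :
    Tendsto (fun ε : ℝ => fA A ((x : ℂ) + σ * (ε * I))) (𝓝[>] 0)
      (𝓝 (((A : ℂ) - x + σ * (I * √(1 - x ^ 2))) ^ ((1 : ℂ) / 2))⁻¹) := by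
  have hs2 : √(1 - x ^ 2) ^ 2 = 1 - x ^ 2 := Real.sq_sqrt (by nlinarith [hx.1, hx.2])
  have hphi := tendsto_phi_cut hσ hx
  set s := √(1 - x ^ 2)
  have hσc : (σ : ℂ) ^ 2 = 1 := by exact_mod_cast hσ
  have hsc : (s : ℂ) ^ 2 = 1 - (x : ℂ) ^ 2 := by exact_mod_cast hs2
  have hmul : ((x : ℂ) + σ * (I * s)) * (x - σ * (I * s)) = 1 := by
    linear_combination -(σ ^ 2 * s ^ 2 * I_sq) + s ^ 2 * hσc + hsc
  have hne : (x : ℂ) + σ * (I * s) ≠ 0 := left_ne_zero_of_mul_eq_one hmul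
  have hinv : (A : ℂ) - 1 / (x + σ * (I * s)) = A - x + σ * (I * s) := by
    rw [one_div, inv_eq_of_mul_eq_one_right hmul]
    ring
  have hslit : (A : ℂ) - x + σ * (I * s) ∈ slitPlane := by
    left
    simp
    linarith [hx.2]
  have hlim : Tendsto (fun ε : ℝ => (A : ℂ) - 1 / phi ((x : ℂ) + σ * (ε * I))) (𝓝[>] 0)
      (𝓝 (A - x + σ * (I * s))) := by
    rw [← hinv]
    exact tendsto_const_nhds.sub (tendsto_const_nhds.div hphi hne)
  rw [← cpow_neg]
  exact (continuousAt_cpow_const hslit).tendsto.comp hlim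

/-- The product of the principal square roots of two conjugate numbers in the slit plane. -/
theorem cpow_half_mul_conj {u : ℂ} (hu : u ∈ slitPlane) :
    u ^ ((1 : ℂ) / 2) * (starRingEnd ℂ u) ^ ((1 : ℂ) / 2) = ‖u‖ := by
  have hconj : (starRingEnd ℂ u) ^ ((1 : ℂ) / 2) = starRingEnd ℂ (u ^ ((1 : ℂ) / 2)) := by
    rw [conj_cpow _ _ (slitPlane_arg_ne_pi hu), map_div₀, map_one, conj_ofNat]
  rw [hconj, mul_conj, normSq_eq_norm_sq, ← norm_pow, cpow_half_sq]

/-- For `A > 1`, `a = (A + 1/A)/2`, `x ∈ (−1,1)`: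
`f_A⁺(x) − f_A⁻(x) = −2i√(1−x²) / (√(2A(a−x)) · h_A(x))`. -/
theorem fA_jump (A : ℝ) (hA : 1 < A) (x : ℝ) (hx : x ∈ Set.Ioo (-1 : ℝ) 1)
    (p m : ℂ)
    (hp : Tendsto (fun ε : ℝ => fA A ((x : ℂ) + ε * Complex.I)) (𝓝[>] 0) (𝓝 p))
    (hm : Tendsto (fun ε : ℝ => fA A ((x : ℂ) - ε * Complex.I)) (𝓝[>] 0) (𝓝 m)) :
    p - m = (-2 * Complex.I * (Real.sqrt (1 - x ^ 2) : ℂ)) /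
      ((Real.sqrt (2 * A * ((A + 1 / A) / 2 - x)) : ℂ) * hfun A x) := by
  have hs : 0 < √(1 - x ^ 2) := Real.sqrt_pos.2 (by nlinarith [hx.1, hx.2])
  have hs2 : √(1 - x ^ 2) ^ 2 = 1 - x ^ 2 := Real.sq_sqrt (by nlinarith [hx.1, hx.2])
  have hp' := tendsto_nhds_unique hp
    (by simpa [-one_div] using tendsto_fA_cut (σ := 1) hA (by norm_num) hx)
  have hm' := tendsto_nhds_unique hm
    (by simpa [-one_div, ← sub_eq_add_neg] using tendsto_fA_cut (σ := -1) hA (by norm_num) hx)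
  rw [hfun, hp', hm']
  set s := √(1 - x ^ 2)
  have hslit : (A : ℂ) - x + I * s ∈ slitPlane := by
    left
    simp
    linarith [hx.2]
  have hnorm : ‖(A : ℂ) - x + I * s‖ = √(2 * A * ((A + 1 / A) / 2 - x)) := by
    rw [Complex.norm_def, normSq_apply]
    congr 1
    simp
    field_simp
    linear_combination hs2
  have hprod := cpow_half_mul_conj hslit
  have hconj : starRingEnd ℂ ((A : ℂ) - x + I * s) = A - x - I * s := by
    simp [sub_eq_add_neg]
  rw [hconj, hnorm] at hprod
  rw [← hprod]
  have hu := cpow_half_sq ((A : ℂ) - x + I * s)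
  have hv := cpow_half_sq ((A : ℂ) - x - I * s)
  have hpos : (√(2 * A * ((A + 1 / A) / 2 - x)) : ℂ) ≠ 0 := by
    rw [← hnorm]
    exact_mod_cast norm_ne_zero_iff.2 (slitPlane_ne_zero hslit)
  rw [← hprod] at hpos
  set U := ((A : ℂ) - x + I * s) ^ ((1 : ℂ) / 2)
  set V := ((A : ℂ) - x - I * s) ^ ((1 : ℂ) / 2)
  have hU : U ≠ 0 := left_ne_zero_of_mul hpos
  have hV : V ≠ 0 := right_ne_zero_of_mul hpos
  have hsum : V + U ≠ 0 := by
    intro h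
    have : 2 * I * (s : ℂ) = 0 := by linear_combination (U - V) * h - hu + hv
    simp [hs.ne'] at this
  field_simp
  linear_combination hv - hu
end

section
/- For every x ∈ (−1,1): f⁺(x) − f⁻(x) = −(i/2) · √(1−x²) · [h₂(x)/h₁(x) + h₁(x)/h₂(x)] / (√(A₁A₂) · √((a₁−x)(a₂−x))). -/
open Complex Filter Topology

/-- `f(z) = [(A₁ − 1/φ(z))(A₂ − 1/φ(z))]^{−1/2}`, principal square root. -/
noncomputable def ff (A₁ A₂ : ℝ) (z : ℂ) : ℂ :=
  (((A₁ : ℂ) - 1 / phi z) * ((A₂ : ℂ) - 1 / phi z)) ^ (-(1 / 2) : ℂ)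

/-- In the upper half-plane the branch `z·(1 − z⁻²)^{1/2}` is `i·(1 − z²)^{1/2}`. -/
theorem phi_eq_of_im_pos {z : ℂ} (hz : 0 < z.im) :
    phi z = z + I * (1 - z ^ 2) ^ ((1 : ℂ) / 2) := by
  have hz0 : z ≠ 0 := by
    rintro rfl
    simp at hz
  unfold phi
  set c : ℂ := (1 - 1 / z ^ 2) ^ ((1 : ℂ) / 2) with hc
  set d : ℂ := (1 - z ^ 2) ^ ((1 : ℂ) / 2) with hd
  have hc2 : c ^ 2 = 1 - 1 / z ^ 2 := by
    rw [hc, one_div (2 : ℂ)]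
    exact cpow_nat_inv_pow _ two_ne_zero
  have hd2 : d ^ 2 = 1 - z ^ 2 := by
    rw [hd, one_div (2 : ℂ)]
    exact cpow_nat_inv_pow _ two_ne_zero
  have hcre : 0 ≤ c.re := by
    rw [hc, one_div (2 : ℂ), cpow_inv_two_re]
    positivity
  have hdre : 0 ≤ d.re := by
    rw [hd, one_div (2 : ℂ), cpow_inv_two_re]
    positivity
  have hzc : (z * c) ^ 2 = z ^ 2 - 1 := by
    rw [mul_pow, hc2]
    field_simp
  have hdot : (z * c).re * z.re + (z * c).im * z.im = (z.re ^ 2 + z.im ^ 2) * c.re := by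
    rw [mul_re, mul_im]
    ring
  generalize z * c = w at hzc hdot ⊢
  have hre := congrArg re hzc
  have him := congrArg im hzc
  simp only [pow_two, mul_re, mul_im, sub_re, sub_im, one_re, one_im] at hre him
  have hpos : 0 < w.im := by
    by_contra! hneg
    have hdot0 : 0 ≤ w.re * z.re + w.im * z.im := by
      rw [hdot]
      positivity
    have hre0 : z.re = 0 := by
      have hnonneg : 0 ≤ w.re * z.re := by
        linarith [mul_nonpos_of_nonpos_of_nonneg hneg hz.le]
      have hprod : w.re * z.re * w.im = z.re ^ 2 * z.im := by
        linear_combination z.re / 2 * him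
      have hle := mul_nonpos_of_nonneg_of_nonpos hnonneg hneg
      rw [hprod] at hle
      exact pow_eq_zero_iff two_ne_zero |>.mp
        (le_antisymm (nonpos_of_mul_nonpos_left hle hz) (sq_nonneg _))
    have hw : w.im = 0 := by
      rw [hre0] at hdot0
      nlinarith
    rw [hre0, hw] at hre
    nlinarith
  rcases sq_eq_sq_iff_eq_or_eq_neg.mp
    (show w ^ 2 = (I * d) ^ 2 by rw [hzc, mul_pow, hd2, I_sq]; ring) with h | h
  · rw [h]
  · rw [h] at hpos
    simp at hpos
    linarith

theorem phi_neg (z : ℂ) : phi (-z) = -phi z := by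
  simp [phi]
  ring

theorem tendsto_phi_upper {x : ℝ} (hx : x ∈ Set.Ioo (-1 : ℝ) 1) :
    Tendsto (fun ε : ℝ => phi ((x : ℂ) + ε * I)) (𝓝[>] 0)
      (𝓝 (x + I * Real.sqrt (1 - x ^ 2))) := by
  have hpos : 0 < 1 - x ^ 2 := by nlinarith [hx.1, hx.2]
  have hval : (1 - (x : ℂ) ^ 2) ^ ((1 : ℂ) / 2) = Real.sqrt (1 - x ^ 2) := by
    rw [Real.sqrt_eq_rpow, ofReal_cpow hpos.le]
    push_cast
    rfl
  have hcont : ContinuousAt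
      (fun ε : ℝ => (x : ℂ) + ε * I + I * (1 - ((x : ℂ) + ε * I) ^ 2) ^ ((1 : ℂ) / 2)) 0 := by
    refine ContinuousAt.add (by fun_prop) (continuousAt_const.mul ?_)
    refine ContinuousAt.cpow (by fun_prop) continuousAt_const ?_
    left
    simpa [pow_two] using by nlinarith
  have ht := hcont.tendsto.mono_left (nhdsWithin_le_nhds (s := Set.Ioi (0 : ℝ)))
  simp only [ofReal_zero, zero_mul, add_zero, hval] at ht
  refine ht.congr' ?_
  filter_upwards [self_mem_nhdsWithin] with ε hε
  rw [phi_eq_of_im_pos]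
  simpa using hε

theorem tendsto_phi_lower {x : ℝ} (hx : x ∈ Set.Ioo (-1 : ℝ) 1) :
    Tendsto (fun ε : ℝ => phi ((x : ℂ) - ε * I)) (𝓝[>] 0)
      (𝓝 (x - I * Real.sqrt (1 - x ^ 2))) := by
  have h := (tendsto_phi_upper (x := -x) ⟨by linarith [hx.2], by linarith [hx.1]⟩).neg
  convert h using 2
  · rw [← phi_neg]
    congr 1
    push_cast
    ring
  · push_cast
    rw [neg_sq]
    ring

/-- Boundary values of `ff` along a filter on which `phi` tends to the unit-circle point
`x - i t`. -/
theorem tendsto_ff {A₁ A₂ x t : ℝ} (hA₁ : x < A₁) (hA₂ : x < A₂) (ht : t ≠ 0)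
    (hxt : x ^ 2 + t ^ 2 = 1) {l : Filter ℝ} {g : ℝ → ℂ}
    (hg : Tendsto (fun ε => phi (g ε)) l (𝓝 (x - I * t))) :
    Tendsto (fun ε => ff A₁ A₂ (g ε)) l
      (𝓝 ((((A₁ : ℂ) - x - I * t) * ((A₂ : ℂ) - x - I * t)) ^ (-(1 / 2) : ℂ))) := by
  have hmul : ((x : ℂ) - I * t) * (x + I * t) = 1 := by
    have : (x : ℂ) ^ 2 + (t : ℂ) ^ 2 = 1 := by exact_mod_cast hxt
    linear_combination this - (t : ℂ) ^ 2 * I_sq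
  have hne : (x : ℂ) - I * t ≠ 0 := left_ne_zero_of_mul_eq_one hmul
  have hinv : 1 / ((x : ℂ) - I * t) = x + I * t := by
    rw [div_eq_iff hne, mul_comm, hmul]
  have hlim : Tendsto (fun ε => 1 / phi (g ε)) l (𝓝 (x + I * t)) := by
    rw [← hinv]
    exact tendsto_const_nhds.div hg hne
  have hprod := (hlim.const_sub (A₁ : ℂ)).mul (hlim.const_sub (A₂ : ℂ))
  simp only [← sub_sub] at hprod
  refine hprod.cpow tendsto_const_nhds ?_
  right
  have : (((A₁ : ℂ) - x - I * t) * ((A₂ : ℂ) - x - I * t)).im = -(t * (A₁ + A₂ - 2 * x)) := by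
    simp
    ring
  rw [this]
  exact neg_ne_zero.mpr (mul_ne_zero ht (by linarith))

/-- A product of two numbers with positive real part, raised to the power `-1/2`. -/
theorem mul_cpow_neg_half {α β : ℂ} (hα : 0 < α.re) (hβ : 0 < β.re) :
    (α * β) ^ (-(1 / 2) : ℂ) = 1 / (α ^ ((1 : ℂ) / 2) * β ^ ((1 : ℂ) / 2)) := by
  have h1 := abs_lt.mp (abs_arg_lt_pi_div_two_iff.mpr (Or.inl hα))
  have h2 := abs_lt.mp (abs_arg_lt_pi_div_two_iff.mpr (Or.inl hβ))
  have hα0 : α ≠ 0 := by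
    rintro rfl
    simp at hα
  have hβ0 : β ≠ 0 := by
    rintro rfl
    simp at hβ
  rw [cpow_neg, one_div (_ * _), cpow_def_of_ne_zero (mul_ne_zero hα0 hβ0),
    cpow_def_of_ne_zero hα0, cpow_def_of_ne_zero hβ0,
    log_mul hα0 hβ0 ⟨by linarith, by linarith⟩, add_mul, exp_add]

/-- Cartesian form of the principal square roots of `r ± i t` for `r > 0`. -/
theorem exists_sqrt_re_im {r : ℝ} (hr : 0 < r) (t : ℝ) :
    ∃ c d : ℝ, 0 < c ∧ c ^ 2 - d ^ 2 = r ∧ 2 * c * d = t ∧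
      ((r : ℂ) + I * t) ^ ((1 : ℂ) / 2) = c + d * I ∧
      ((r : ℂ) - I * t) ^ ((1 : ℂ) / 2) = c - d * I := by
  set u : ℂ := ((r : ℂ) + I * t) ^ ((1 : ℂ) / 2) with hu
  have hu2 : u ^ 2 = (r : ℂ) + I * t := by
    rw [hu, one_div (2 : ℂ)]
    exact cpow_nat_inv_pow _ two_ne_zero
  have hre := congrArg re hu2
  have him := congrArg im hu2
  simp [pow_two] at hre him
  have hure : 0 ≤ u.re := by
    rw [hu, one_div (2 : ℂ), cpow_inv_two_re]
    positivity
  have harg : ((r : ℂ) + I * t).arg ≠ Real.pi := by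
    rw [Ne, arg_eq_pi_iff]
    simp [hr.le]
  refine ⟨u.re, u.im, ?_, by linarith, by linarith, (re_add_im u).symm, ?_⟩
  · refine hure.lt_of_ne ?_
    intro h
    rw [← h] at hre
    nlinarith
  · have h := cpow_conj ((r : ℂ) + I * t) ((1 : ℂ) / 2) harg
    have h2 : (starRingEnd ℂ) ((1 : ℂ) / 2) = 1 / 2 := by simp [Complex.conj_ofNat]
    have h3 : (starRingEnd ℂ) ((r : ℂ) + I * t) = r - I * t := by
      simp [sub_eq_add_neg]
    rw [h2, h3, ← hu] at h
    rw [← conj_conj (((r : ℂ) - I * t) ^ ((1 : ℂ) / 2)), ← h]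
    apply Complex.ext <;> simp

/-- For `1 < A₁ < A₂`, `aⱼ = (Aⱼ + 1/Aⱼ)/2`, `x ∈ (−1,1)`:
`f⁺(x) − f⁻(x) = −(i/2)·√(1−x²)·[h₂(x)/h₁(x) + h₁(x)/h₂(x)] / (√(A₁A₂)·√((a₁−x)(a₂−x)))`. -/
theorem ff_jump (A₁ A₂ : ℝ) (hA₁ : 1 < A₁) (hA₁₂ : A₁ < A₂)
    (x : ℝ) (hx : x ∈ Set.Ioo (-1 : ℝ) 1) (p m : ℂ)
    (hp : Tendsto (fun ε : ℝ => ff A₁ A₂ ((x : ℂ) + ε * Complex.I)) (𝓝[>] 0) (𝓝 p))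
    (hm : Tendsto (fun ε : ℝ => ff A₁ A₂ ((x : ℂ) - ε * Complex.I)) (𝓝[>] 0) (𝓝 m)) :
    p - m = -(Complex.I / 2) * (Real.sqrt (1 - x ^ 2) : ℂ) *
        (hfun A₂ x / hfun A₁ x + hfun A₁ x / hfun A₂ x) /
      ((Real.sqrt (A₁ * A₂) : ℂ) *
        (Real.sqrt (((A₁ + 1 / A₁) / 2 - x) * ((A₂ + 1 / A₂) / 2 - x)) : ℂ)) := by
  have hpos : 0 < 1 - x ^ 2 := by nlinarith [hx.1, hx.2]
  have hx1 : x < 1 := hx.2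
  set s : ℝ := Real.sqrt (1 - x ^ 2) with hs
  have hs0 : 0 < s := Real.sqrt_pos.mpr hpos
  have hs2 : s ^ 2 = 1 - x ^ 2 := Real.sq_sqrt hpos.le
  have hr₁ : 0 < A₁ - x := by linarith
  have hr₂ : 0 < A₂ - x := by linarith
  have hp' := tendsto_nhds_unique hp (tendsto_ff (x := x) (t := -s) (by linarith) (by linarith)
    (neg_ne_zero.mpr hs0.ne') (by linarith [neg_sq s])
    (by simpa using tendsto_phi_upper hx))
  have hm' := tendsto_nhds_unique hm (tendsto_ff (t := s) (by linarith) (by linarith)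
    hs0.ne' (by linarith) (tendsto_phi_lower hx))
  rw [mul_cpow_neg_half (by simpa using hx1.trans hA₁)
    (by simpa using hx1.trans (hA₁.trans hA₁₂))] at hp' hm'
  obtain ⟨c₁, d₁, hc₁, hr, hs₁, hu₁, hv₁⟩ := exists_sqrt_re_im hr₁ s
  obtain ⟨c₂, d₂, hc₂, hr', hs₂, hu₂, hv₂⟩ := exists_sqrt_re_im hr₂ s
  simp only [ofReal_sub, ofReal_neg, mul_neg, sub_neg_eq_add] at hu₁ hv₁ hu₂ hv₂ hp' hm'
  have hden : Real.sqrt (A₁ * A₂) * Real.sqrt (((A₁ + 1 / A₁) / 2 - x) *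
      ((A₂ + 1 / A₂) / 2 - x)) = (c₁ ^ 2 + d₁ ^ 2) * (c₂ ^ 2 + d₂ ^ 2) / 2 := by
    have hA₁0 : A₁ ≠ 0 := by linarith
    have hA₂0 : A₂ ≠ 0 := by linarith
    have hn₁ : (c₁ ^ 2 + d₁ ^ 2) ^ 2 = 2 * A₁ * ((A₁ + 1 / A₁) / 2 - x) := by
      have : 2 * A₁ * ((A₁ + 1 / A₁) / 2 - x) = (A₁ - x) ^ 2 + s ^ 2 := by
        rw [hs2]
        field_simp
        ring
      rw [this, ← hr, ← hs₁]
      ring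
    have hn₂ : (c₂ ^ 2 + d₂ ^ 2) ^ 2 = 2 * A₂ * ((A₂ + 1 / A₂) / 2 - x) := by
      have : 2 * A₂ * ((A₂ + 1 / A₂) / 2 - x) = (A₂ - x) ^ 2 + s ^ 2 := by
        rw [hs2]
        field_simp
        ring
      rw [this, ← hr', ← hs₂]
      ring
    rw [← Real.sqrt_mul (mul_nonneg (by linarith) (by linarith)),
      Real.sqrt_eq_iff_mul_self_eq_of_pos (by positivity)]
    linear_combination (c₂ ^ 2 + d₂ ^ 2) ^ 2 / 4 * hn₁ +
      A₁ * ((A₁ + 1 / A₁) / 2 - x) / 2 * hn₂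
  rw [← ofReal_mul, hden, hp', hm']
  simp only [hfun, ← hs, hu₁, hv₁, hu₂, hv₂]
  have hc₁' : (c₁ : ℂ) ≠ 0 := by exact_mod_cast hc₁.ne'
  have hc₂' : (c₂ : ℂ) ≠ 0 := by exact_mod_cast hc₂.ne'
  have hu₁0 : (c₁ : ℂ) + d₁ * I ≠ 0 := fun h => hc₁.ne' (by simpa using congrArg re h)
  have hv₁0 : (c₁ : ℂ) - d₁ * I ≠ 0 := fun h => hc₁.ne' (by simpa using congrArg re h)
  have hu₂0 : (c₂ : ℂ) + d₂ * I ≠ 0 := fun h => hc₂.ne' (by simpa using congrArg re h)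
  have hv₂0 : (c₂ : ℂ) - d₂ * I ≠ 0 := fun h => hc₂.ne' (by simpa using congrArg re h)
  have hsum (c d : ℂ) : c - d * I + (c + d * I) = 2 * c := by ring
  have hnorm (c d : ℂ) : c ^ 2 + d ^ 2 = (c + d * I) * (c - d * I) := by
    linear_combination d ^ 2 * I_sq
  have hnum : (s : ℂ) * (2 * c₂ / (2 * c₁) + 2 * c₁ / (2 * c₂)) =
      2 * (d₁ * c₂ + c₁ * d₂) := by
    have h₁ : (2 : ℂ) * c₁ * d₁ = s := by exact_mod_cast hs₁
    have h₂ : (2 : ℂ) * c₂ * d₂ = s := by exact_mod_cast hs₂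
    field_simp
    linear_combination -(c₂ : ℂ) ^ 2 * h₁ - (c₁ : ℂ) ^ 2 * h₂
  have hsub {a b c d : ℂ} (ha : a ≠ 0) (hb : b ≠ 0) (hc : c ≠ 0) (hd : d ≠ 0) :
      1 / (a * b) - 1 / (c * d) = (c * d - a * b) / (a * c * (b * d)) := by
    field_simp
  push_cast
  rw [hsum, hsum, mul_assoc, hnum, hnorm, hnorm, hsub hu₁0 hu₂0 hv₁0 hv₂0]
  generalize ((c₁ : ℂ) + d₁ * I) * (c₁ - d₁ * I) * ((c₂ + d₂ * I) * (c₂ - d₂ * I)) = N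
  ring
end

section
/- For every z ∈ ℂ∖[−1,1]: f(z) = 1/√(A₁A₂) + ∫_{−1}^{1} w(x)/(z−x) dx. Moreover w(x) > 0 for every x ∈ (−1,1), so f − 1/√(A₁A₂) is the Cauchy transform of a positive measure whose support is [−1,1] (i.e., f is a Markov function up to the additive constant 1/√(A₁A₂)). -/
open Complex Filter Topology intervalIntegral

/-- The density `w(x) = √(1−x²)·[h₂/h₁ + h₁/h₂] / (4π√(A₁A₂)·√((a₁−x)(a₂−x)))`. -/
noncomputable def w (A₁ A₂ x : ℝ) : ℂ :=
  (Real.sqrt (1 - x ^ 2) : ℂ) * (hfun A₂ x / hfun A₁ x + hfun A₁ x / hfun A₂ x) /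
    ((4 * Real.pi * Real.sqrt (A₁ * A₂) *
      Real.sqrt (((A₁ + 1 / A₁) / 2 - x) * ((A₂ + 1 / A₂) / 2 - x)) : ℝ) : ℂ)

lemma joukowsky_sub_cos {ζ : ℂ} (h0 : ζ ≠ 0) (θ : ℝ) :
    2 * ζ * circleMap 0 1 θ * ((ζ + ζ⁻¹) / 2 - Real.cos θ) =
      (circleMap 0 1 θ - ζ) * (1 - ζ * circleMap 0 1 θ) := by
  have ht : exp (θ * I) ≠ 0 := exp_ne_zero _
  simp only [circleMap, ofReal_one, one_mul, zero_add, ofReal_cos, Complex.cos, neg_mul,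
    Complex.exp_neg]
  field_simp
  ring

/-- The Cauchy kernel on `[-1, 1]`, pulled back to the unit circle, is a combination of
Cauchy kernels of the disc. -/
lemma sin_div_sub_cos_eq {ζ : ℂ} (h0 : ζ ≠ 0) (h1 : ‖ζ‖ < 1) (θ : ℝ) :
    (Real.sin θ : ℂ) / ((ζ + ζ⁻¹) / 2 - Real.cos θ) =
      (circleMap 0 1 θ * I) * ((circleMap 0 1 θ - ζ)⁻¹ - (circleMap 0 1 θ - 0)⁻¹ -
        ζ / (1 - ζ * circleMap 0 1 θ)) ∧ (ζ + ζ⁻¹) / 2 - (Real.cos θ : ℂ) ≠ 0 := by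
  have hn : ‖circleMap 0 1 θ‖ = 1 := by simp
  have ht : circleMap 0 1 θ ≠ 0 := by intro h; simp [h] at hn
  have ha : circleMap 0 1 θ - ζ ≠ 0 := by
    intro h; rw [sub_eq_zero.1 h] at hn; linarith
  have hb : 1 - ζ * circleMap 0 1 θ ≠ 0 := by
    intro h
    have := congrArg norm (sub_eq_zero.1 h)
    rw [norm_mul, hn] at this
    simp at this; linarith
  have hk := joukowsky_sub_cos h0 θ
  have hd : (ζ + ζ⁻¹) / 2 - (Real.cos θ : ℂ) ≠ 0 := by
    intro h; rw [h, mul_zero] at hk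
    exact mul_ne_zero ha hb hk.symm
  refine ⟨?_, hd⟩
  have hs : 2 * I * circleMap 0 1 θ * Real.sin θ = circleMap 0 1 θ ^ 2 - 1 := by
    have ht' : exp (θ * I) ≠ 0 := exp_ne_zero _
    simp only [circleMap, ofReal_one, one_mul, zero_add, ofReal_sin, Complex.sin, neg_mul,
      Complex.exp_neg]
    field_simp
    linear_combination (1 - exp (I * θ) ^ 2) * I_sq
  generalize circleMap 0 1 θ = t at *
  generalize (ζ + ζ⁻¹) / 2 - (Real.cos θ : ℂ) = d at *
  generalize (Real.sin θ : ℂ) = s at *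
  have hs' : s = -I * (t ^ 2 - 1) / (2 * t) := by
    field_simp; linear_combination -I * hs + 2 * t * s * I_sq
  have hd' : d = (t - ζ) * (1 - ζ * t) / (2 * ζ * t) := by
    field_simp; linear_combination hk
  have hb' : 1 - t * ζ ≠ 0 := by rwa [mul_comm]
  rw [hs', hd', sub_zero]
  field_simp
  ring

/-- Cauchy's formula on the unit circle, folded onto the upper half circle. -/
lemma integral_sub_mul_sin_div {F : ℂ → ℂ}
    (hF : ∀ t ∈ Metric.closedBall (0 : ℂ) 1, DifferentiableAt ℂ F t) {ζ : ℂ} (h0 : ζ ≠ 0)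
    (h1 : ‖ζ‖ < 1) :
    ∫ θ in (0 : ℝ)..Real.pi, (F (circleMap 0 1 θ) - F (circleMap 0 1 (-θ))) *
        (Real.sin θ / ((ζ + ζ⁻¹) / 2 - Real.cos θ)) =
      2 * Real.pi * I * (F ζ - F 0) := by
  have hmem : ∀ θ : ℝ, circleMap (0 : ℂ) 1 θ ∈ Metric.closedBall (0 : ℂ) 1 :=
    fun θ => circleMap_mem_closedBall _ zero_le_one _
  have hFc : Continuous fun θ : ℝ => F (circleMap 0 1 θ) :=
    continuous_iff_continuousAt.2 fun θ =>
      (hF _ (hmem θ)).continuousAt.comp (continuous_circleMap 0 1).continuousAt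
  have hKc : Continuous fun θ : ℝ => (Real.sin θ : ℂ) / ((ζ + ζ⁻¹) / 2 - Real.cos θ) :=
    Continuous.div (by fun_prop) (by fun_prop) fun θ => (sin_div_sub_cos_eq h0 h1 θ).2
  set G : ℝ → ℂ := fun θ => F (circleMap 0 1 θ) *
    (Real.sin θ / ((ζ + ζ⁻¹) / 2 - Real.cos θ)) with hG
  have hGc : Continuous G := hFc.mul hKc
  have hGn : Continuous fun θ => G (-θ) := hGc.comp continuous_neg
  have hper : Function.Periodic G (2 * Real.pi) := by
    intro θ
    simp only [hG, Real.sin_add_two_pi, Real.cos_add_two_pi, (periodic_circleMap 0 1) θ]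
  have hpt : ∀ θ : ℝ, (F (circleMap 0 1 θ) - F (circleMap 0 1 (-θ))) *
      (Real.sin θ / ((ζ + ζ⁻¹) / 2 - Real.cos θ)) = G θ + G (-θ) := by
    intro θ
    simp only [hG, Real.sin_neg, Real.cos_neg, ofReal_neg]
    ring
  have hadd : ∫ θ in (0 : ℝ)..Real.pi, (G θ + G (-θ)) = ∫ θ in (0 : ℝ)..2 * Real.pi, G θ := by
    rw [intervalIntegral.integral_add (hGc.intervalIntegrable _ _)
      (hGn.intervalIntegrable _ _), intervalIntegral.integral_comp_neg,
      add_comm, neg_zero, intervalIntegral.integral_add_adjacent_intervals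
      (hGc.intervalIntegrable _ _) (hGc.intervalIntegrable _ _)]
    have := hper.intervalIntegral_add_eq (-Real.pi) 0
    rw [zero_add] at this
    rw [← this]
    congr 1
    ring
  have hdiff : DifferentiableOn ℂ F (Metric.closedBall 0 1) :=
    fun t ht => (hF t ht).differentiableWithinAt
  have hcirc : ∫ θ in (0 : ℝ)..2 * Real.pi, G θ =
      ∮ t in C(0, 1), (((t - ζ)⁻¹ • F t - (t - 0)⁻¹ • F t) - ζ / (1 - ζ * t) * F t) := by
    unfold circleIntegral
    congr 1
    ext θ
    simp only [hG, (sin_div_sub_cos_eq h0 h1 θ).1, deriv_circleMap, smul_eq_mul]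
    ring
  have hden : ∀ t ∈ Metric.closedBall (0 : ℂ) 1, 1 - ζ * t ≠ 0 := by
    intro t ht h
    have h2 := congrArg norm (sub_eq_zero.1 h)
    rw [norm_mul, norm_one] at h2
    have h3 : ‖t‖ ≤ 1 := by simpa using ht
    nlinarith [norm_nonneg ζ, norm_nonneg t]
  have hHd : DifferentiableOn ℂ (fun t => ζ / (1 - ζ * t) * F t) (Metric.closedBall 0 1) :=
    (DifferentiableOn.div (by fun_prop) (by fun_prop) hden).mul hdiff
  have hsph : Metric.sphere (0 : ℂ) 1 ⊆ Metric.closedBall 0 1 := Metric.sphere_subset_closedBall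
  have hker : ∀ v : ℂ, ‖v‖ < 1 →
      CircleIntegrable (fun t => (t - v)⁻¹ • F t) 0 1 := by
    intro v hv
    refine ContinuousOn.circleIntegrable zero_le_one (ContinuousOn.smul (ContinuousOn.inv₀
      (continuousOn_id.sub continuousOn_const) fun t ht h => ?_) (hdiff.continuousOn.mono hsph))
    have : ‖t‖ = 1 := by simpa using ht
    rw [show t = v from sub_eq_zero.1 h] at this
    linarith
  have hkk : CircleIntegrable (fun t => (t - ζ)⁻¹ • F t - (t - 0)⁻¹ • F t) 0 1 :=
    (hker ζ h1).sub (hker 0 (by simp))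
  have hHz : ∮ t in C(0, 1), ζ / (1 - ζ * t) * F t = 0 :=
    circleIntegral_eq_zero_of_differentiable_on_off_countable zero_le_one Set.countable_empty
      hHd.continuousOn fun t ht => (hHd t (Metric.ball_subset_closedBall ht.1)).differentiableAt
        (Metric.closedBall_mem_nhds_of_mem ht.1)
  rw [intervalIntegral.integral_congr fun θ _ => hpt θ, hadd, hcirc,
    circleIntegral.integral_sub hkk
      ((hHd.continuousOn.mono hsph).circleIntegrable zero_le_one), hHz,
    circleIntegral.integral_sub (hker ζ h1) (hker 0 (by simp)),
    hdiff.circleIntegral_sub_inv_smul (by simpa using h1),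
    hdiff.circleIntegral_sub_inv_smul (by simp)]
  simp only [smul_eq_mul]
  ring

/-- Off the cut, `1 / phi z` is the preimage of `z` under the Joukowsky map in the punctured
unit disc. -/
lemma one_div_phi_mem_punctured_disc {z : ℂ} (hz : z ∉ ofReal '' Set.Icc (-1 : ℝ) 1) :
    1 / phi z ≠ 0 ∧ ‖1 / phi z‖ < 1 ∧ (1 / phi z + (1 / phi z)⁻¹) / 2 = z := by
  have hz0 : z ≠ 0 := by
    rintro rfl
    exact hz ⟨0, by norm_num, by simp⟩
  set q : ℂ := (1 - 1 / z ^ 2) ^ ((1 : ℂ) / 2) with hq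
  have hq2 : q ^ 2 = 1 - 1 / z ^ 2 := by
    rw [hq, one_div (2 : ℂ)]
    exact cpow_ofNat_inv_pow _ 2
  have hre : 0 ≤ q.re := by
    rw [hq, one_div (2 : ℂ), cpow_inv_two_re]
    positivity
  have hre' : q.re ≠ 0 := by
    intro h
    have h2 : z ^ 2 * ((1 + q.im ^ 2 : ℝ) : ℂ) = 1 := by
      have h3 : q = q.im * I := by apply Complex.ext <;> simp [h]
      have h4 : q ^ 2 = -(q.im : ℂ) ^ 2 := by
        conv_lhs => rw [h3]
        rw [mul_pow, I_sq]; ring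
      rw [h4] at hq2
      push_cast
      field_simp at hq2
      linear_combination -hq2
    have hpos : 0 < 1 + q.im ^ 2 := by positivity
    set r := Real.sqrt (1 + q.im ^ 2) with hr
    have hr2 : r ^ 2 = 1 + q.im ^ 2 := Real.sq_sqrt hpos.le
    have hr1 : 1 ≤ r := by rw [hr]; exact Real.one_le_sqrt.2 (by nlinarith [sq_nonneg q.im])
    have hr0 : (r : ℂ) ≠ 0 := by
      exact_mod_cast (by linarith : r ≠ 0)
    have h5 : (z * r) ^ 2 = 1 := by
      rw [mul_pow, ← h2, ← hr2]; push_cast; ring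
    have hi : r⁻¹ ≤ 1 := inv_le_one_of_one_le₀ hr1
    have hi0 : 0 ≤ r⁻¹ := by positivity
    rcases sq_eq_one_iff.1 h5 with h6 | h6
    · exact hz ⟨r⁻¹, ⟨by linarith, hi⟩, by push_cast; field_simp; linear_combination -h6⟩
    · refine hz ⟨-r⁻¹, ⟨by linarith, by linarith⟩, ?_⟩
      push_cast
      field_simp
      linear_combination -h6
  have hpos : 0 < q.re := lt_of_le_of_ne hre (Ne.symm hre')
  have hphi : phi z = z * (1 + q) := by rw [phi, ← hq]; ring
  have hmul : phi z * (z * (1 - q)) = 1 := by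
    rw [hphi]
    have : z ^ 2 * (1 - q ^ 2) = 1 := by rw [hq2]; field_simp; ring
    linear_combination this
  have hp0 : phi z ≠ 0 := left_ne_zero_of_mul_eq_one hmul
  have hinv : 1 / phi z = z * (1 - q) := by field_simp; linear_combination -hmul
  have hlt : ‖1 - q‖ < ‖1 + q‖ := by
    rw [← sq_lt_sq₀ (norm_nonneg _) (norm_nonneg _), Complex.sq_norm, Complex.sq_norm,
      normSq_apply, normSq_apply]
    simp only [sub_re, sub_im, add_re, add_im, one_re, one_im]
    nlinarith
  refine ⟨one_div_ne_zero hp0, ?_, ?_⟩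
  · have h1 : ‖1 / phi z‖ < ‖phi z‖ := by
      rw [hinv, hphi, norm_mul, norm_mul]
      exact mul_lt_mul_of_pos_left hlt (norm_pos_iff.2 hz0)
    have h2 : ‖1 / phi z‖ * ‖phi z‖ = 1 := by
      rw [← norm_mul, one_div_mul_cancel hp0, norm_one]
    by_contra! h3
    nlinarith
  · rw [one_div, inv_inv, ← one_div, hinv, hphi]
    ring

/-- The principal square root of `A - ζ`. -/
noncomputable def sqrtSub (A : ℝ) (ζ : ℂ) : ℂ := ((A : ℂ) - ζ) ^ ((1 : ℂ) / 2)

lemma sqrtSub_sq (A : ℝ) (ζ : ℂ) : sqrtSub A ζ ^ 2 = A - ζ := by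
  rw [sqrtSub, one_div]
  exact cpow_ofNat_inv_pow _ 2

lemma re_sub_pos {A : ℝ} {ζ : ℂ} (hA : 1 < A) (hζ : ‖ζ‖ ≤ 1) : 0 < ((A : ℂ) - ζ).re := by
  have := (re_le_norm ζ).trans hζ
  simp only [sub_re, ofReal_re]
  linarith

lemma sqrtSub_ne_zero {A : ℝ} {ζ : ℂ} (hA : 1 < A) (hζ : ‖ζ‖ ≤ 1) : sqrtSub A ζ ≠ 0 := by
  intro h
  have h2 := sqrtSub_sq A ζ
  have h3 := re_sub_pos hA hζ
  rw [← h2, h] at h3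
  simp at h3

lemma differentiableAt_sqrtSub {A : ℝ} {ζ : ℂ} (hA : 1 < A) (hζ : ‖ζ‖ ≤ 1) :
    DifferentiableAt ℂ (sqrtSub A) ζ :=
  DifferentiableAt.cpow (by fun_prop) (by fun_prop) (Or.inl (re_sub_pos hA hζ))

lemma sqrtSub_conj {A : ℝ} {ζ : ℂ} (hA : 1 < A) (hζ : ‖ζ‖ ≤ 1) :
    sqrtSub A (starRingEnd ℂ ζ) = starRingEnd ℂ (sqrtSub A ζ) := by
  have harg : ((A : ℂ) - ζ).arg ≠ Real.pi :=
    slitPlane_arg_ne_pi (Or.inl (re_sub_pos hA hζ))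
  have := conj_cpow ((A : ℂ) - ζ) ((1 : ℂ) / 2) harg
  simpa [sqrtSub, map_ofNat] using this

lemma re_sqrtSub_pos {A : ℝ} {ζ : ℂ} (hA : 1 < A) (hζ : ‖ζ‖ ≤ 1) : 0 < (sqrtSub A ζ).re := by
  have h0 : 0 ≤ (sqrtSub A ζ).re := by
    rw [sqrtSub, one_div, cpow_inv_two_re]
    positivity
  refine lt_of_le_of_ne h0 fun h => ?_
  have h2 := re_sub_pos hA hζ
  rw [← sqrtSub_sq A ζ, sq, mul_re, ← h] at h2
  nlinarith [mul_self_nonneg (sqrtSub A ζ).im]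

lemma cpow_neg_half_eq {A₁ A₂ : ℝ} {ζ : ℂ} (hA₁ : 1 < A₁) (hA₂ : 1 < A₂) (hζ : ‖ζ‖ ≤ 1) :
    (((A₁ : ℂ) - ζ) * ((A₂ : ℂ) - ζ)) ^ (-(1 / 2) : ℂ) = (sqrtSub A₁ ζ * sqrtSub A₂ ζ)⁻¹ := by
  have h1 := re_sub_pos hA₁ hζ
  have h2 := re_sub_pos hA₂ hζ
  have g1 := abs_lt.1 (abs_arg_lt_pi_div_two_iff.2 (Or.inl h1))
  have g2 := abs_lt.1 (abs_arg_lt_pi_div_two_iff.2 (Or.inl h2))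
  have n1 : (A₁ : ℂ) - ζ ≠ 0 := fun h => by simp [h] at h1
  have n2 : (A₂ : ℂ) - ζ ≠ 0 := fun h => by simp [h] at h2
  rw [cpow_neg, cpow_def_of_ne_zero (mul_ne_zero n1 n2), sqrtSub, sqrtSub,
    cpow_def_of_ne_zero n1, cpow_def_of_ne_zero n2, ← Complex.exp_add,
    Complex.log_mul n1 n2 ⟨by linarith, by linarith⟩, add_mul]

/-- Both square roots in `hfun` are values of `sqrtSub` on the unit circle. -/
lemma hfun_eq_sqrtSub {A x : ℝ} {t : ℂ} (ht : t = x + I * Real.sqrt (1 - x ^ 2)) :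
    hfun A x = sqrtSub A t + sqrtSub A (starRingEnd ℂ t) := by
  subst ht
  simp only [hfun, sqrtSub, map_add, map_mul, conj_ofReal, conj_I]
  congr 2 <;> ring

lemma norm_boundary {x : ℝ} (hx : x ∈ Set.Icc (-1 : ℝ) 1) :
    ‖(x : ℂ) + I * Real.sqrt (1 - x ^ 2)‖ = 1 := by
  have h : 0 ≤ 1 - x ^ 2 := by nlinarith [hx.1, hx.2]
  rw [mul_comm, Complex.norm_add_mul_I, Real.sq_sqrt h]
  simp

lemma hfun_eq_ofReal {A x : ℝ} (hA : 1 < A) (hx : x ∈ Set.Icc (-1 : ℝ) 1) :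
    ∃ r : ℝ, 0 < r ∧ hfun A x = r := by
  have hn := (norm_boundary hx).le
  refine ⟨_, mul_pos two_pos (re_sqrtSub_pos hA hn), ?_⟩
  rw [hfun_eq_sqrtSub rfl, sqrtSub_conj hA hn, add_conj]

lemma joukowsky_gt_one {A : ℝ} (hA : 1 < A) : 1 < (A + 1 / A) / 2 := by
  have h0 : 0 < A := by linarith
  rw [lt_div_iff₀ two_pos]
  have : A + 1 / A - 2 = (A - 1) ^ 2 / A := by field_simp; ring
  have h1 : 0 < A - 1 := by linarith
  have h2 : 0 < (A - 1) ^ 2 / A := by positivity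
  linarith

lemma w_denominator_pos {A₁ A₂ x : ℝ} (hA₁ : 1 < A₁) (hA₂ : 1 < A₂) (hx : x ≤ 1) :
    0 < 4 * Real.pi * Real.sqrt (A₁ * A₂) *
      Real.sqrt (((A₁ + 1 / A₁) / 2 - x) * ((A₂ + 1 / A₂) / 2 - x)) := by
  have h1 : 0 < (A₁ + 1 / A₁) / 2 - x := by linarith [joukowsky_gt_one hA₁]
  have h2 : 0 < (A₂ + 1 / A₂) / 2 - x := by linarith [joukowsky_gt_one hA₂]
  have := Real.pi_pos
  have h3 : 0 < A₁ * A₂ := by nlinarith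
  positivity

lemma w_pos {A₁ A₂ x : ℝ} (hA₁ : 1 < A₁) (hA₂ : 1 < A₂) (hx : x ∈ Set.Ioo (-1 : ℝ) 1) :
    (w A₁ A₂ x).im = 0 ∧ 0 < (w A₁ A₂ x).re := by
  obtain ⟨r₁, h1, e1⟩ := hfun_eq_ofReal hA₁ (Set.Ioo_subset_Icc_self hx)
  obtain ⟨r₂, h2, e2⟩ := hfun_eq_ofReal hA₂ (Set.Ioo_subset_Icc_self hx)
  have hd := w_denominator_pos hA₁ hA₂ hx.2.le
  have hs : 0 < Real.sqrt (1 - x ^ 2) := Real.sqrt_pos.2 (by nlinarith [hx.1, hx.2])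
  rw [w, e1, e2]
  norm_cast
  exact ⟨rfl, by positivity⟩

lemma sqrtSub_mul_conj {A x : ℝ} (hA : 1 < A) {t : ℂ} (ht : ‖t‖ = 1) (hx : t.re = x) :
    sqrtSub A t * starRingEnd ℂ (sqrtSub A t) = Real.sqrt (2 * A * ((A + 1 / A) / 2 - x)) := by
  have hA0 : A ≠ 0 := by linarith
  have h1 : ‖sqrtSub A t‖ ^ 2 = ‖(A : ℂ) - t‖ := by rw [← norm_pow, sqrtSub_sq]
  have h2 : t.re ^ 2 + t.im ^ 2 = 1 := by
    have := Complex.sq_norm t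
    rw [ht, normSq_apply] at this
    linarith
  rw [mul_conj, normSq_eq_norm_sq, h1, Complex.norm_def, normSq_apply]
  congr 2
  simp only [sub_re, sub_im, ofReal_re, ofReal_im]
  field_simp
  rw [← hx]
  linear_combination h2

/-- The density is the jump of `1 / √((A₁ - ζ)(A₂ - ζ))` across the cut. -/
lemma w_cos {A₁ A₂ θ : ℝ} (hA₁ : 1 < A₁) (hA₂ : 1 < A₂) (hθ : θ ∈ Set.Icc 0 Real.pi) :
    w A₁ A₂ (Real.cos θ) = (2 * Real.pi * I)⁻¹ *
      ((sqrtSub A₁ (circleMap 0 1 θ) * sqrtSub A₂ (circleMap 0 1 θ))⁻¹ -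
       (sqrtSub A₁ (circleMap 0 1 (-θ)) * sqrtSub A₂ (circleMap 0 1 (-θ)))⁻¹) := by
  have hs : Real.sqrt (1 - Real.cos θ ^ 2) = Real.sin θ := by
    rw [← Real.sin_sq, Real.sqrt_sq (Real.sin_nonneg_of_nonneg_of_le_pi hθ.1 hθ.2)]
  set t : ℂ := circleMap 0 1 θ with ht
  have htx : t = Real.cos θ + I * Real.sin θ := by
    simp only [ht, circleMap, ofReal_one, one_mul, zero_add, exp_mul_I, ofReal_cos, ofReal_sin]
    ring
  have hc : circleMap 0 1 (-θ) = starRingEnd ℂ t := by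
    rw [htx]
    simp only [circleMap, ofReal_one, one_mul, zero_add, exp_mul_I, ofReal_cos, ofReal_sin,
      ofReal_neg, Complex.cos_neg, Complex.sin_neg, map_add, map_mul, conj_I, ← Complex.cos_conj,
      ← Complex.sin_conj, conj_ofReal]
    ring
  have hn : ‖t‖ = 1 := by simp [ht]
  have hx : t = Real.cos θ + I * Real.sqrt (1 - Real.cos θ ^ 2) := by rw [hs]; exact htx
  have hre : t.re = Real.cos θ := by rw [htx]; simp [-ofReal_cos, -ofReal_sin]
  have hcn : ‖starRingEnd ℂ t‖ ≤ 1 := by simp [hn]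
  rw [hc, w, hfun_eq_sqrtSub hx, hfun_eq_sqrtSub hx, hs]
  have ha1 := joukowsky_gt_one hA₁
  have ha2 := joukowsky_gt_one hA₂
  have hcos := Real.cos_le_one θ
  have e1 := sqrtSub_mul_conj hA₁ hn hre
  have e2 := sqrtSub_mul_conj hA₂ hn hre
  rw [← sqrtSub_conj hA₁ hn.le] at e1
  rw [← sqrtSub_conj hA₂ hn.le] at e2
  have hden : ((4 * Real.pi * Real.sqrt (A₁ * A₂) * Real.sqrt (((A₁ + 1 / A₁) / 2 - Real.cos θ) *
      ((A₂ + 1 / A₂) / 2 - Real.cos θ)) : ℝ) : ℂ) = 2 * Real.pi *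
      ((sqrtSub A₁ t * sqrtSub A₁ (starRingEnd ℂ t)) *
        (sqrtSub A₂ t * sqrtSub A₂ (starRingEnd ℂ t))) := by
    rw [e1, e2]
    norm_cast
    have h1 : 0 ≤ (A₁ + 1 / A₁) / 2 - Real.cos θ := by linarith
    have h2 : 0 ≤ (A₂ + 1 / A₂) / 2 - Real.cos θ := by linarith
    rw [← Real.sqrt_mul (by positivity), mul_assoc, ← Real.sqrt_mul (by positivity),
      show 2 * A₁ * ((A₁ + 1 / A₁) / 2 - Real.cos θ) * (2 * A₂ * ((A₂ + 1 / A₂) / 2 - Real.cos θ))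
        = 2 ^ 2 * (A₁ * A₂ * (((A₁ + 1 / A₁) / 2 - Real.cos θ) *
          ((A₂ + 1 / A₂) / 2 - Real.cos θ))) by ring,
      Real.sqrt_mul (by norm_num) (A₁ * A₂ * _), Real.sqrt_sq (by norm_num)]
    ring
  have s1 := sqrtSub_sq A₁ t
  have s2 := sqrtSub_sq A₂ t
  have c1 := sqrtSub_sq A₁ (starRingEnd ℂ t)
  have c2 := sqrtSub_sq A₂ (starRingEnd ℂ t)
  have n1 := sqrtSub_ne_zero hA₁ hn.le
  have n2 := sqrtSub_ne_zero hA₂ hn.le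
  have m1 := sqrtSub_ne_zero hA₁ hcn
  have m2 := sqrtSub_ne_zero hA₂ hcn
  have hsum : ∀ {A : ℝ}, 1 < A → sqrtSub A t + sqrtSub A (starRingEnd ℂ t) ≠ 0 := by
    intro A hA h
    have h2 := re_sqrtSub_pos hA hn.le
    rw [sqrtSub_conj hA hn.le] at h
    have := congrArg re h
    simp at this
    linarith
  have k1 := hsum hA₁
  have k2 := hsum hA₂
  have htt : t - starRingEnd ℂ t = 2 * I * Real.sin θ := by
    rw [htx]
    simp only [map_add, map_mul, conj_ofReal, conj_I]
    ring
  rw [hden]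
  generalize sqrtSub A₁ t = u₁ at *
  generalize sqrtSub A₂ t = u₂ at *
  generalize sqrtSub A₁ (starRingEnd ℂ t) = v₁ at *
  generalize sqrtSub A₂ (starRingEnd ℂ t) = v₂ at *
  have hpi : (Real.pi : ℂ) ≠ 0 := by exact_mod_cast Real.pi_ne_zero
  have d1 : (v₁ - u₁) * (u₁ + v₁) = 2 * I * Real.sin θ := by linear_combination c1 - s1 + htt
  have d2 : (v₂ - u₂) * (u₂ + v₂) = 2 * I * Real.sin θ := by linear_combination c2 - s2 + htt
  generalize (Real.sin θ : ℂ) = s at *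
  field_simp
  linear_combination (-(u₂ + v₂) ^ 2 * d1 - (u₁ + v₁) ^ 2 * d2) / 2

lemma continuousOn_w {A₁ A₂ : ℝ} (hA₁ : 1 < A₁) (hA₂ : 1 < A₂) :
    ContinuousOn (w A₁ A₂) (Set.Icc (-1) 1) := by
  have hh : ∀ {A : ℝ}, 1 < A → ContinuousOn (hfun A) (Set.Icc (-1) 1) := by
    intro A hA
    unfold hfun
    refine ContinuousOn.add (ContinuousOn.cpow (by fun_prop) (by fun_prop) fun x hx => Or.inl ?_)
      (ContinuousOn.cpow (by fun_prop) (by fun_prop) fun x hx => Or.inl ?_)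
    all_goals
      simp
      linarith [hx.2]
  have hne : ∀ {A : ℝ}, 1 < A → ∀ x ∈ Set.Icc (-1 : ℝ) 1, hfun A x ≠ 0 := by
    intro A hA x hx
    obtain ⟨r, hr, e⟩ := hfun_eq_ofReal hA hx
    rw [e]
    exact_mod_cast hr.ne'
  unfold w
  refine ContinuousOn.div (ContinuousOn.mul (by fun_prop)
    (((hh hA₂).div (hh hA₁) (hne hA₁)).add ((hh hA₁).div (hh hA₂) (hne hA₂)))) (by fun_prop) ?_
  intro x hx
  exact_mod_cast (w_denominator_pos hA₁ hA₂ hx.2).ne'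

lemma sqrtSub_zero {A : ℝ} (hA : 0 ≤ A) : sqrtSub A 0 = Real.sqrt A := by
  rw [sqrtSub, sub_zero, Real.sqrt_eq_rpow, ofReal_cpow hA]
  norm_num

/-- For every `z ∉ [−1,1]`: `f(z) = 1/√(A₁A₂) + ∫_{−1}^{1} w(x)/(z−x) dx`, and `w(x) > 0`
for every `x ∈ (−1,1)`; thus `f − 1/√(A₁A₂)` is the Cauchy transform of a positive measure
supported on `[−1,1]` (`f` is a Markov function up to an additive constant). -/
theorem ff_is_markov (A₁ A₂ : ℝ) (hA₁ : 1 < A₁) (hA₁₂ : A₁ < A₂) :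
    (∀ z : ℂ, z ∉ Complex.ofReal '' Set.Icc (-1 : ℝ) 1 →
      ff A₁ A₂ z = ((Real.sqrt (A₁ * A₂) : ℂ))⁻¹ +
        ∫ x in (-1 : ℝ)..1, w A₁ A₂ x / (z - (x : ℂ))) ∧
    ∀ x ∈ Set.Ioo (-1 : ℝ) 1, (w A₁ A₂ x).im = 0 ∧ 0 < (w A₁ A₂ x).re := by
  have hA₂ : 1 < A₂ := hA₁.trans hA₁₂
  refine ⟨fun z hz => ?_, fun x hx => w_pos hA₁ hA₂ hx⟩
  obtain ⟨h0, h1, hzeq⟩ := one_div_phi_mem_punctured_disc hz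
  have hff : ff A₁ A₂ z = (sqrtSub A₁ (1 / phi z) * sqrtSub A₂ (1 / phi z))⁻¹ :=
    cpow_neg_half_eq hA₁ hA₂ h1.le
  rw [hff]
  generalize 1 / phi z = ζ at *
  set F : ℂ → ℂ := fun t => (sqrtSub A₁ t * sqrtSub A₂ t)⁻¹ with hF
  have hFd : ∀ t ∈ Metric.closedBall (0 : ℂ) 1, DifferentiableAt ℂ F t := by
    intro t ht
    have ht' : ‖t‖ ≤ 1 := by simpa using ht
    exact ((differentiableAt_sqrtSub hA₁ ht').mul (differentiableAt_sqrtSub hA₂ ht')).inv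
      (mul_ne_zero (sqrtSub_ne_zero hA₁ ht') (sqrtSub_ne_zero hA₂ ht'))
  have hF0 : F 0 = (Real.sqrt (A₁ * A₂) : ℂ)⁻¹ := by
    simp only [hF]
    rw [sqrtSub_zero (by linarith), sqrtSub_zero (by linarith), Real.sqrt_mul (by linarith)]
    push_cast
    rfl
  have hgc : ContinuousOn (fun x : ℝ => w A₁ A₂ x / (z - x)) (Set.Icc (-1) 1) :=
    (continuousOn_w hA₁ hA₂).div (by fun_prop) fun x hx h => hz ⟨x, hx, (sub_eq_zero.1 h).symm⟩
  have hsub := intervalIntegral.integral_deriv_smul_comp' (a := 0) (b := Real.pi) (f := Real.cos)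
    (f' := fun θ => -Real.sin θ) (g := fun x : ℝ => w A₁ A₂ x / (z - x))
    (fun θ _ => Real.hasDerivAt_cos θ) (by fun_prop)
    (hgc.mono (by rintro _ ⟨θ, _, rfl⟩; exact Real.cos_mem_Icc θ))
  rw [Real.cos_zero, Real.cos_pi] at hsub
  have hint : ∫ x in (-1 : ℝ)..1, w A₁ A₂ x / (z - (x : ℂ)) = F ζ - F 0 := by
    rw [intervalIntegral.integral_symm, ← hsub, ← intervalIntegral.integral_neg]
    have hpi : (2 * Real.pi * I : ℂ) ≠ 0 := by simp [Real.pi_ne_zero]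
    rw [← mul_right_inj' hpi, ← integral_sub_mul_sin_div hFd h0 h1,
      ← intervalIntegral.integral_const_mul]
    refine intervalIntegral.integral_congr fun θ hθ => ?_
    rw [Set.uIcc_of_le Real.pi_pos.le] at hθ
    simp only [Function.comp_apply, w_cos hA₁ hA₂ hθ, hF, real_smul, ofReal_neg, hzeq]
    field_simp
  rw [hint, hF0]
  ring
end

section
/- For every x ∈ (−1,1): f⁺(x)·f⁻(x) = 1 / (2√(A₁A₂(a₁−x)(a₂−x))). -/
open Complex Filter Topology

open ComplexConjugate in
theorem phi_conj {z : ℂ} (hz : (1 - 1 / z ^ 2).arg ≠ Real.pi) : phi (conj z) = conj (phi z) := by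
  have h := conj_cpow (1 - 1 / z ^ 2) (1 / 2) hz
  simp only [map_sub, map_div₀, map_one, map_pow, map_ofNat] at h
  simp only [phi, map_add, map_mul, h]

theorem phi_quadratic {z : ℂ} (hz : z ≠ 0) : phi z ^ 2 - 2 * z * phi z + 1 = 0 := by
  have h : ((1 - 1 / z ^ 2) ^ ((1 : ℂ) / 2)) ^ 2 = 1 - 1 / z ^ 2 := by
    rw [← cpow_mul_nat]
    norm_num
  have h2 : z ^ 2 * (1 - 1 / z ^ 2) = z ^ 2 - 1 := by field_simp
  unfold phi
  linear_combination z ^ 2 * h + h2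

theorem one_le_norm_phi {z : ℂ} (hz : z ≠ 0) : 1 ≤ ‖phi z‖ := by
  have hq := phi_quadratic hz
  set r := (1 - 1 / z ^ 2) ^ ((1 : ℂ) / 2) with hr
  have hre : 0 ≤ r.re := by
    by_cases h0 : 1 - 1 / z ^ 2 = 0
    · rw [hr, h0, zero_cpow (by norm_num)]
      simp
    · have harg := Complex.abs_arg_le_pi (1 - 1 / z ^ 2)
      rw [abs_le] at harg
      rw [hr, cpow_def_of_ne_zero h0, Complex.exp_re]
      refine mul_nonneg (Real.exp_pos _).le (Real.cos_nonneg_of_mem_Icc ?_)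
      have : (log (1 - 1 / z ^ 2) * (1 / 2)).im = (1 - 1 / z ^ 2).arg / 2 := by
        rw [show (1 / 2 : ℂ) = ((1 / 2 : ℝ) : ℂ) by norm_num, im_mul_ofReal, log_im]
        ring
      rw [this]
      constructor <;> linarith
  have hphi : phi z = z * (1 + r) := by rw [phi, ← hr]; ring
  have hprod : phi z * (z * (1 - r)) = 1 := by
    have : z * (1 - r) = 2 * z - phi z := by rw [hphi]; ring
    rw [this]
    linear_combination -hq
  have hle : ‖1 - r‖ ≤ ‖1 + r‖ := by
    rw [← sq_le_sq₀ (norm_nonneg _) (norm_nonneg _), ← normSq_eq_norm_sq, ← normSq_eq_norm_sq,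
      normSq_apply, normSq_apply]
    simp
    nlinarith
  have h1 : ‖phi z‖ * (‖z‖ * ‖1 - r‖) = 1 := by
    rw [← norm_mul, ← norm_mul, hprod, norm_one]
  have h2 : ‖phi z‖ = ‖z‖ * ‖1 + r‖ := by rw [hphi, norm_mul]
  have h3 := mul_le_mul_of_nonneg_left hle (norm_nonneg z)
  rw [← h2] at h3
  nlinarith [norm_nonneg (phi z)]

theorem arg_mul_ne_pi_of_re_pos {u v : ℂ} (hu : 0 < u.re) (hv : 0 < v.re) :
    (u * v).arg ≠ Real.pi := by
  rw [Ne, arg_eq_pi_iff, mul_re, mul_im]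
  rintro ⟨h1, h2⟩
  have h3 : 0 < u.im * v.im := by nlinarith [mul_pos hu hv]
  have h4 : u.re * (u.im * v.im) + u.im ^ 2 * v.re = 0 := by linear_combination u.im * h2
  nlinarith [mul_pos hu h3, mul_nonneg (sq_nonneg u.im) hv.le]

theorem re_sub_pos_of_norm_le_one {A : ℝ} (hA : 1 < A) {w : ℂ} (hw : ‖w‖ ≤ 1) :
    0 < ((A : ℂ) - w).re := by
  rw [sub_re, ofReal_re]
  linarith [re_le_norm w]

theorem norm_one_div_phi_le {z : ℂ} (hz : z ≠ 0) : ‖1 / phi z‖ ≤ 1 := by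
  rw [norm_div, norm_one]
  exact div_le_one_of_le₀ (one_le_norm_phi hz) (norm_nonneg _)

open ComplexConjugate in
theorem ff_conj {A₁ A₂ : ℝ} (hA₁ : 1 < A₁) (hA₂ : 1 < A₂) {z : ℂ} (hz : z ≠ 0)
    (hz' : (1 - 1 / z ^ 2).arg ≠ Real.pi) : ff A₁ A₂ (conj z) = conj (ff A₁ A₂ z) := by
  have hw := norm_one_div_phi_le hz
  have h := conj_cpow _ (-(1 / 2)) (arg_mul_ne_pi_of_re_pos
    (re_sub_pos_of_norm_le_one hA₁ hw) (re_sub_pos_of_norm_le_one hA₂ hw))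
  simp only [map_sub, map_mul, map_div₀, map_one, map_neg, map_ofNat, conj_ofReal] at h
  simp only [ff, phi_conj hz', h]

theorem norm_ff_sq (A₁ A₂ : ℝ) (z : ℂ) :
    ‖ff A₁ A₂ z‖ ^ 2 = (‖(A₁ : ℂ) - 1 / phi z‖ * ‖(A₂ : ℂ) - 1 / phi z‖)⁻¹ := by
  rw [← norm_mul, ← norm_inv, ← norm_pow, ff, ← cpow_mul_nat]
  norm_num [cpow_neg_one]

theorem arg_one_sub_one_div_sq_ne_pi {x ε : ℝ} (hε : 0 < ε) :
    (1 - 1 / ((x : ℂ) + ε * I) ^ 2).arg ≠ Real.pi := by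
  set z : ℂ := (x : ℂ) + ε * I with hz
  have hzim : z.im = ε := by simp [hz]
  have hzre : z.re = x := by simp [hz]
  have hz0 : z ≠ 0 := fun h => hε.ne' (by rw [← hzim, h, zero_im])
  rw [Ne, arg_eq_pi_iff]
  rintro ⟨h1, h2⟩
  set t := (1 - 1 / z ^ 2).re
  have h3 : (1 - 1 / z ^ 2) = (t : ℂ) := Complex.ext rfl h2
  have h4 : z ^ 2 * (1 - t) = 1 := by
    rw [← h3]
    field_simp
    ring
  have hre := congrArg re h4
  have him := congrArg im h4
  simp [pow_two, hzim, hzre] at hre him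
  have h5 : 0 < 1 - t := by linarith
  rcases him with him | him
  · have hx : x = 0 := by
      have : x * ε = 0 := by linarith
      exact (mul_eq_zero.mp this).resolve_right hε.ne'
    subst hx
    nlinarith [mul_pos (mul_pos hε hε) h5]
  · linarith

/-- The modulus `‖A - 1/φ(x + iε)‖` tends to `√(A² - 2Ax + 1)` at the cut. -/
theorem tendsto_norm_sub_one_div_phi (A : ℝ) {x : ℝ} (hx : x ∈ Set.Ioo (-1 : ℝ) 1) :
    Tendsto (fun ε : ℝ => ‖(A : ℂ) - 1 / phi ((x : ℂ) + ε * I)‖) (𝓝[>] 0)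
      (𝓝 (Real.sqrt (A ^ 2 - 2 * A * x + 1))) := by
  have hs : 0 ≤ 1 - x ^ 2 := by nlinarith [hx.1, hx.2]
  have hss := Real.sq_sqrt hs
  set s := Real.sqrt (1 - x ^ 2)
  have hnorm (σ : ℝ) (hσ : σ ^ 2 = 1 - x ^ 2) :
      ‖(A : ℂ) - (x + σ * I)‖ = Real.sqrt (A ^ 2 - 2 * A * x + 1) := by
    rw [Complex.norm_def, normSq_apply]
    congr 1
    simp
    linear_combination hσ
  have hbound : ∀ ε : ℝ, 0 < ε →
      ‖‖(A : ℂ) - 1 / phi ((x : ℂ) + ε * I)‖ - Real.sqrt (A ^ 2 - 2 * A * x + 1)‖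
        ≤ Real.sqrt (2 * ε) := by
    intro ε hε
    set z : ℂ := (x : ℂ) + ε * I with hz
    have hz0 : z ≠ 0 := fun h => hε.ne' (by simpa [hz] using congrArg im h)
    have hq := phi_quadratic hz0
    have hw := norm_one_div_phi_le hz0
    have hp0 : phi z ≠ 0 := fun h => by
      have := one_le_norm_phi hz0
      rw [h, norm_zero] at this
      linarith
    set w := 1 / phi z with hwdef
    have hwq : w ^ 2 - 2 * z * w + 1 = 0 := by
      rw [hwdef]
      field_simp
      linear_combination hq
    have hssC : (s : ℂ) ^ 2 = 1 - (x : ℂ) ^ 2 := by exact_mod_cast hss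
    have hprod : (w - (x + s * I)) * (w - (x + (-s : ℝ) * I)) = 2 * ε * I * w := by
      push_cast
      rw [hz] at hwq
      linear_combination hwq + hssC - s ^ 2 * I_sq
    have hnp : ‖w - (x + s * I)‖ * ‖w - (x + (-s : ℝ) * I)‖ ≤ 2 * ε := by
      rw [← norm_mul, hprod]
      simp only [norm_mul, norm_I, norm_real, Real.norm_eq_abs, abs_of_pos hε, Complex.norm_ofNat]
      nlinarith
    have key (σ : ℝ) (hσ : σ ^ 2 = 1 - x ^ 2) (hle : ‖w - (x + σ * I)‖ ^ 2 ≤ 2 * ε) :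
        ‖‖(A : ℂ) - w‖ - Real.sqrt (A ^ 2 - 2 * A * x + 1)‖ ≤ Real.sqrt (2 * ε) := by
      rw [← hnorm σ hσ]
      refine (abs_norm_sub_norm_le _ _).trans ?_
      rw [sub_sub_sub_cancel_left, norm_sub_rev]
      exact Real.le_sqrt_of_sq_le hle
    rcases le_total ‖w - (x + s * I)‖ ‖w - (x + (-s : ℝ) * I)‖ with h | h
    · refine key s hss ?_
      nlinarith [norm_nonneg (w - (x + s * I))]
    · refine key (-s) (by rw [neg_sq, hss]) ?_
      nlinarith [norm_nonneg (w - (x + (-s : ℝ) * I))]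
  rw [tendsto_iff_norm_sub_tendsto_zero]
  refine squeeze_zero' (Eventually.of_forall fun _ => norm_nonneg _)
    (eventually_nhdsWithin_of_forall fun ε hε => hbound ε hε) ?_
  have : Tendsto (fun ε : ℝ => Real.sqrt (2 * ε)) (𝓝 0) (𝓝 (Real.sqrt (2 * 0))) :=
    (by fun_prop : Continuous fun ε : ℝ => Real.sqrt (2 * ε)).tendsto 0
  rw [mul_zero, Real.sqrt_zero] at this
  exact this.mono_left nhdsWithin_le_nhds

/-- For every `x ∈ (−1,1)`: `f⁺(x)·f⁻(x) = 1 / (2√(A₁A₂(a₁−x)(a₂−x)))`. -/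
theorem ff_prod (A₁ A₂ : ℝ) (hA₁ : 1 < A₁) (hA₁₂ : A₁ < A₂)
    (x : ℝ) (hx : x ∈ Set.Ioo (-1 : ℝ) 1) (p m : ℂ)
    (hp : Tendsto (fun ε : ℝ => ff A₁ A₂ ((x : ℂ) + ε * Complex.I)) (𝓝[>] 0) (𝓝 p))
    (hm : Tendsto (fun ε : ℝ => ff A₁ A₂ ((x : ℂ) - ε * Complex.I)) (𝓝[>] 0) (𝓝 m)) :
    p * m = ((2 * Real.sqrt
      (A₁ * A₂ * ((A₁ + 1 / A₁) / 2 - x) * ((A₂ + 1 / A₂) / 2 - x)) : ℝ) : ℂ)⁻¹ := by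
  have hA₂ : 1 < A₂ := hA₁.trans hA₁₂
  have hpos {A : ℝ} (hA : 1 < A) : 0 < A ^ 2 - 2 * A * x + 1 := by
    nlinarith [sq_nonneg (A - 1), hx.2]
  have hconj : m = (starRingEnd ℂ) p := by
    refine tendsto_nhds_unique hm
      (((continuous_conj.tendsto p).comp hp).congr' (eventually_nhdsWithin_of_forall fun ε hε => ?_))
    have hε₀ : (0 : ℝ) < ε := hε
    have hz0 : (x : ℂ) + ε * I ≠ 0 := fun h => hε₀.ne' (by simpa using congrArg im h)
    rw [Function.comp_apply, ← ff_conj hA₁ hA₂ hz0 (arg_one_sub_one_div_sq_ne_pi hε₀)]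
    simp [sub_eq_add_neg]
  have hlim : ‖p‖ ^ 2 = (Real.sqrt (A₁ ^ 2 - 2 * A₁ * x + 1)
      * Real.sqrt (A₂ ^ 2 - 2 * A₂ * x + 1))⁻¹ := by
    refine tendsto_nhds_unique (hp.norm.pow 2) ?_
    simp only [norm_ff_sq]
    exact ((tendsto_norm_sub_one_div_phi A₁ hx).mul (tendsto_norm_sub_one_div_phi A₂ hx)).inv₀
      (mul_pos (Real.sqrt_pos.mpr (hpos hA₁)) (Real.sqrt_pos.mpr (hpos hA₂))).ne'
  rw [hconj, mul_conj, normSq_eq_norm_sq, hlim, ← ofReal_inv, ← Real.sqrt_mul (hpos hA₁).le,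
    show (A₁ ^ 2 - 2 * A₁ * x + 1) * (A₂ ^ 2 - 2 * A₂ * x + 1) = 2 ^ 2 *
      (A₁ * A₂ * ((A₁ + 1 / A₁) / 2 - x) * ((A₂ + 1 / A₂) / 2 - x)) by
        field_simp [(zero_lt_one.trans hA₁).ne', (zero_lt_one.trans hA₂).ne']
        ring,
    Real.sqrt_mul (by norm_num), Real.sqrt_sq (by norm_num)]
end
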